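/- (Two-dimensional Harnack inequality) Let λ ∈ (0,1], let a be a measurable coefficient field on B₁ ⊂ ℝ² that is uniformly elliptic with constant λ, and let v ∈ C¹(B₁) be a weak solution of div(a∇v) = 0 in B₁ with v > 0 on B₁. Then there exists a constant C > 0 depending only on λ such that sup_{B_{1/4}} v ≤ C · inf_{B_{1/4}} v. -/

import Mathlib

open MeasureTheory Metric

noncomputable section

/-- A coefficient field `a` on `U ⊆ ℝ²` is uniformly elliptic with constant `lam ∈ (0,1]`. -/
def UniformlyElliptic (lam : ℝ) (U : Set (EuclideanSpace ℝ (Fin 2)))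
    (a : EuclideanSpace ℝ (Fin 2) → Matrix (Fin 2) (Fin 2) ℝ) : Prop :=
  ∀ x ∈ U, (a x).IsSymm ∧
    ∀ ξ : EuclideanSpace ℝ (Fin 2),
      lam * ‖ξ‖ ^ 2 ≤ ∑ i, ∑ j, ξ i * a x i j * ξ j ∧
        ∑ i, ∑ j, ξ i * a x i j * ξ j ≤ lam⁻¹ * ‖ξ‖ ^ 2

/-- `v` is a weak solution of `div(a ∇v) = 0` in `U`. -/
def IsWeakSolution (U : Set (EuclideanSpace ℝ (Fin 2)))
    (a : EuclideanSpace ℝ (Fin 2) → Matrix (Fin 2) (Fin 2) ℝ)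
    (v : EuclideanSpace ℝ (Fin 2) → ℝ) : Prop :=
  ∀ φ : EuclideanSpace ℝ (Fin 2) → ℝ,
    ContDiff ℝ 1 φ → HasCompactSupport φ → tsupport φ ⊆ U →
      ∫ x in U, ∑ i, ∑ j, gradient φ x i * a x i j * gradient v x j = 0

/-- The Euclidean plane. -/
abbrev Plane := EuclideanSpace ℝ (Fin 2)

/-- The bilinear form `ξ · A ζ` of a `2 × 2` matrix. -/
def matForm (A : Matrix (Fin 2) (Fin 2) ℝ) (ξ ζ : Plane) : ℝ :=
  ∑ i, ∑ j, ξ i * A i j * ζ j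

lemma matForm_smul_left (A : Matrix (Fin 2) (Fin 2) ℝ) (c : ℝ) (ξ ζ : Plane) :
    matForm A (c • ξ) ζ = c * matForm A ξ ζ := by
  simp only [matForm, Fin.sum_univ_two, PiLp.smul_apply, smul_eq_mul]
  ring

lemma matForm_smul_right (A : Matrix (Fin 2) (Fin 2) ℝ) (c : ℝ) (ξ ζ : Plane) :
    matForm A ξ (c • ζ) = c * matForm A ξ ζ := by
  simp only [matForm, Fin.sum_univ_two, PiLp.smul_apply, smul_eq_mul]
  ring

lemma matForm_sub_left (A : Matrix (Fin 2) (Fin 2) ℝ) (ξ ξ' ζ : Plane) :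
    matForm A (ξ - ξ') ζ = matForm A ξ ζ - matForm A ξ' ζ := by
  simp only [matForm, Fin.sum_univ_two, PiLp.sub_apply]
  ring

lemma matForm_zero_left (A : Matrix (Fin 2) (Fin 2) ℝ) (ζ : Plane) :
    matForm A 0 ζ = 0 := by
  simp [matForm]

/-- Young's inequality for a nonnegative symmetric form. -/
lemma two_mul_matForm_le {A : Matrix (Fin 2) (Fin 2) ℝ} (hA : A.IsSymm)
    (hpos : ∀ ξ, 0 ≤ matForm A ξ ξ) (p q : Plane) :
    2 * matForm A p q ≤ 2 * matForm A p p + 1 / 2 * matForm A q q := by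
  have h := hpos ((2 : ℝ) • p - q)
  have hs : A 1 0 = A 0 1 := hA.apply 0 1
  simp only [matForm, Fin.sum_univ_two, PiLp.sub_apply, PiLp.smul_apply, smul_eq_mul, hs] at h ⊢
  linarith

section Elliptic

variable {lam : ℝ} {U : Set Plane} {a : Plane → Matrix (Fin 2) (Fin 2) ℝ}

lemma UniformlyElliptic.lower (ha : UniformlyElliptic lam U a) {x : Plane} (hx : x ∈ U)
    (ξ : Plane) : lam * ‖ξ‖ ^ 2 ≤ matForm (a x) ξ ξ :=
  ((ha x hx).2 ξ).1

lemma UniformlyElliptic.upper (ha : UniformlyElliptic lam U a) {x : Plane} (hx : x ∈ U)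
    (ξ : Plane) : matForm (a x) ξ ξ ≤ lam⁻¹ * ‖ξ‖ ^ 2 :=
  ((ha x hx).2 ξ).2

lemma UniformlyElliptic.nonneg (ha : UniformlyElliptic lam U a) (hlam : 0 < lam) {x : Plane}
    (hx : x ∈ U) (ξ : Plane) : 0 ≤ matForm (a x) ξ ξ :=
  le_trans (by positivity) (ha.lower hx ξ)

lemma UniformlyElliptic.abs_entry_le (ha : UniformlyElliptic lam U a) (hlam : 0 < lam)
    {x : Plane} (hx : x ∈ U) (i j : Fin 2) : |a x i j| ≤ lam⁻¹ := by
  have hs : a x 1 0 = a x 0 1 := (ha x hx).1.apply 0 1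
  have key : ∀ s t : ℝ, 0 ≤ s * s * a x 0 0 + 2 * (s * t) * a x 0 1 + t * t * a x 1 1 ∧
      s * s * a x 0 0 + 2 * (s * t) * a x 0 1 + t * t * a x 1 1 ≤ lam⁻¹ * (s ^ 2 + t ^ 2) := by
    intro s t
    have h0 := ha.nonneg hlam hx !₂[s, t]
    have h1 := ha.upper hx !₂[s, t]
    simp only [matForm, Fin.sum_univ_two, EuclideanSpace.norm_sq_eq, Real.norm_eq_abs, sq_abs,
      hs] at h0 h1
    simp at h0 h1
    constructor <;> linarith
  have h1 := key 1 0
  have h2 := key 0 1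
  have h3 := key 1 1
  have h4 := key 1 (-1)
  norm_num at h1 h2 h3 h4
  rw [abs_le]
  fin_cases i <;> fin_cases j <;> simp [hs] <;> constructor <;> linarith

end Elliptic

lemma norm_gradient_eq (f : Plane → ℝ) (x : Plane) : ‖gradient f x‖ = ‖fderiv ℝ f x‖ := by
  simp [gradient]

lemma gradient_eq_zero_of_notMem_tsupport {f : Plane → ℝ} {x : Plane} (hx : x ∉ tsupport f) :
    gradient f x = 0 := by
  have : fderiv ℝ f x = 0 := by
    by_contra h
    exact hx (support_fderiv_subset ℝ h)
  simp [gradient, this]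

lemma continuousOn_gradient {f : Plane → ℝ} {U : Set Plane} (hU : IsOpen U)
    (hf : ContDiffOn ℝ 1 f U) : ContinuousOn (gradient f) U :=
  (InnerProductSpace.toDual ℝ Plane).symm.continuous.comp_continuousOn
    (hf.continuousOn_fderiv_of_isOpen hU le_rfl)

lemma continuousOn_coord {f : Plane → Plane} {U : Set Plane} (hf : ContinuousOn f U) (i : Fin 2) :
    ContinuousOn (fun x => f x i) U :=
  (EuclideanSpace.proj (𝕜 := ℝ) i).continuous.comp_continuousOn hf

/-- The integrand of the weak formulation is integrable. -/
lemma integrableOn_matForm_gradient {lam : ℝ} (hlam : 0 < lam) {U : Set Plane} (hU : IsOpen U)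
    {a : Plane → Matrix (Fin 2) (Fin 2) ℝ} (hm : ∀ i j, Measurable fun x => a x i j)
    (ha : UniformlyElliptic lam U a) {v φ : Plane → ℝ} (hv : ContDiffOn ℝ 1 v U)
    (hφ : ContDiff ℝ 1 φ) (hc : HasCompactSupport φ) (hs : tsupport φ ⊆ U) :
    IntegrableOn (fun x => matForm (a x) (gradient φ x) (gradient v x)) U := by
  refine integrable_finsetSum _ fun i _ => integrable_finsetSum _ fun j _ => ?_
  have h1 : IntegrableOn (fun x => gradient φ x i * gradient v x j) (tsupport φ) := by
    refine ContinuousOn.integrableOn_compact hc ?_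
    exact (continuousOn_coord (continuousOn_gradient isOpen_univ hφ.contDiffOn) i
      |>.mono (Set.subset_univ _)).mul
      (continuousOn_coord ((continuousOn_gradient hU hv).mono hs) j)
  have h2 : Integrable (fun x => gradient φ x i * gradient v x j) := by
    refine (integrableOn_iff_integrable_of_support_subset ?_).1 h1
    intro x hx
    by_contra h
    exact hx (by simp [gradient_eq_zero_of_notMem_tsupport h])
  have h3 : Integrable (fun x => a x i j * (gradient φ x i * gradient v x j))
      (volume.restrict U) := by
    refine Integrable.bdd_mul (c := lam⁻¹) h2.integrableOn (hm i j).aestronglyMeasurable ?_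
    filter_upwards [ae_restrict_mem hU.measurableSet] with x hx
    exact ha.abs_entry_le hlam hx i j
  refine h3.congr (Filter.Eventually.of_forall fun x => ?_)
  simp only
  ring

/-- A function which is `C¹` on an open set containing its closed support is `C¹`. -/
lemma contDiff_of_contDiffOn_of_tsupport_subset {f : Plane → ℝ} {U : Set Plane} (hU : IsOpen U)
    (hf : ContDiffOn ℝ 1 f U) (hs : tsupport f ⊆ U) : ContDiff ℝ 1 f := by
  rw [contDiff_iff_contDiffAt]
  intro x
  by_cases hx : x ∈ tsupport f
  · exact hf.contDiffAt (hU.mem_nhds (hs hx))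
  · exact contDiffAt_const.congr_of_eventuallyEq (notMem_tsupport_iff_eventuallyEq.1 hx)

lemma hasDerivAt_max_zero_sq (t : ℝ) :
    HasDerivAt (fun s : ℝ => max s 0 ^ 2) (2 * max t 0) t := by
  rcases lt_trichotomy t 0 with h | h | h
  · rw [max_eq_right h.le, mul_zero]
    refine (hasDerivAt_const t (0 : ℝ)).congr_of_eventuallyEq ?_
    filter_upwards [gt_mem_nhds h] with s hs
    simp [max_eq_right hs.le]
  · subst h
    rw [hasDerivAt_iff_isLittleO]
    simp only [max_self, mul_zero, smul_zero, sub_zero, ne_eq, OfNat.ofNat_ne_zero,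
      not_false_eq_true, zero_pow]
    refine Asymptotics.IsBigO.trans_isLittleO (g := fun s : ℝ => s ^ 2) ?_ ?_
    · refine Asymptotics.IsBigO.of_bound 1 (Filter.Eventually.of_forall fun s => ?_)
      rw [one_mul, norm_pow, norm_pow]
      gcongr
      rw [Real.norm_eq_abs, Real.norm_eq_abs, abs_of_nonneg (le_max_right _ _)]
      exact max_le (le_abs_self _) (abs_nonneg _)
    · simpa using Asymptotics.isLittleO_pow_id (𝕜 := ℝ) (n := 2) (by norm_num)
  · rw [max_eq_left h.le]
    have h2 : HasDerivAt (fun s : ℝ => s ^ 2) (2 * t) t := by simpa using hasDerivAt_pow 2 t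
    refine h2.congr_of_eventuallyEq ?_
    filter_upwards [lt_mem_nhds h] with s hs
    simp [max_eq_left (le_of_lt hs)]

lemma contDiff_max_zero_sq : ContDiff ℝ 1 (fun s : ℝ => max s 0 ^ 2) := by
  rw [contDiff_one_iff_deriv]
  refine ⟨fun t => (hasDerivAt_max_zero_sq t).differentiableAt, ?_⟩
  have : deriv (fun s : ℝ => max s 0 ^ 2) = fun t => 2 * max t 0 :=
    funext fun t => (hasDerivAt_max_zero_sq t).deriv
  rw [this]
  fun_prop

/-- The weak maximum principle on concentric balls. -/
lemma IsWeakSolution.le_of_le_sphere {lam : ℝ} (hlam : 0 < lam)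
    {a : Plane → Matrix (Fin 2) (Fin 2) ℝ} (hm : ∀ i j, Measurable fun x => a x i j)
    (ha : UniformlyElliptic lam (ball 0 1) a) {v : Plane → ℝ}
    (hv : ContDiffOn ℝ 1 v (ball 0 1)) (hw : IsWeakSolution (ball 0 1) a v)
    {r M : ℝ} (hr : r < 1) (hM : ∀ x ∈ sphere (0 : Plane) r, v x ≤ M) :
    ∀ x ∈ ball (0 : Plane) r, v x ≤ M := by
  intro x₀ hx₀
  by_contra! hlt
  obtain ⟨k, hMk, hkv⟩ := exists_between hlt
  have hsub : ball (0 : Plane) r ⊆ ball 0 1 := ball_subset_ball hr.le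
  have hcsub : closedBall (0 : Plane) r ⊆ ball 0 1 := closedBall_subset_ball hr
  set φ : Plane → ℝ := (ball (0 : Plane) r).indicator (fun x => max (v x - k) 0 ^ 2) with hφdef
  set S : Set Plane := closedBall (0 : Plane) r ∩ v ⁻¹' Set.Ici k with hS
  have hSclosed : IsClosed S :=
    (hv.continuousOn.mono hcsub).preimage_isClosed_of_isClosed isClosed_closedBall isClosed_Ici
  have hφS : tsupport φ ⊆ S := by
    refine closure_minimal ?_ hSclosed
    intro x hx
    have hxb : x ∈ ball (0 : Plane) r := Set.mem_of_indicator_ne_zero hx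
    refine ⟨ball_subset_closedBall hxb, ?_⟩
    by_contra h
    refine hx ?_
    have : v x - k ≤ 0 := by
      have : v x < k := lt_of_not_ge h
      linarith
    simp [hφdef, max_eq_right this]
  have hSb : S ⊆ ball (0 : Plane) r := by
    rintro x ⟨hx, hxk⟩
    by_contra h
    have h1 : x ∈ sphere (0 : Plane) r := by
      simp only [mem_closedBall, mem_ball, mem_sphere] at *
      linarith
    have := hM x h1
    have : k ≤ v x := hxk
    linarith
  have hts : tsupport φ ⊆ ball (0 : Plane) r := hφS.trans hSb
  have hc : HasCompactSupport φ :=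
    HasCompactSupport.of_support_subset_isCompact (isCompact_closedBall (0 : Plane) r)
      (subset_tsupport φ |>.trans (hts.trans ball_subset_closedBall))
  have hφ : ContDiff ℝ 1 φ := by
    refine contDiff_of_contDiffOn_of_tsupport_subset isOpen_ball ?_ hts
    have h1 : ContDiffOn ℝ 1 (fun x => max (v x - k) 0 ^ 2) (ball (0 : Plane) r) :=
      contDiff_max_zero_sq.comp_contDiffOn ((hv.mono hsub).sub contDiffOn_const)
    exact h1.congr fun x hx => Set.indicator_of_mem hx _
  have hgrad : ∀ x ∈ ball (0 : Plane) r,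
      gradient φ x = (2 * max (v x - k) 0) • gradient v x := by
    intro x hx
    have hd : HasFDerivAt v (fderiv ℝ v x) x :=
      ((hv.contDiffAt (isOpen_ball.mem_nhds (hsub hx))).differentiableAt (by norm_num)).hasFDerivAt
    have h1 := (hasDerivAt_max_zero_sq (v x - k)).comp_hasFDerivAt x (hd.sub_const k)
    have h2 : HasFDerivAt φ ((2 * max (v x - k) 0) • fderiv ℝ v x) x := by
      refine h1.congr_of_eventuallyEq ?_
      filter_upwards [isOpen_ball.mem_nhds hx] with y hy
      exact Set.indicator_of_mem hy _
    simp [gradient, h2.fderiv]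
  have hnn : ∀ x ∈ ball (0 : Plane) 1, 0 ≤ matForm (a x) (gradient φ x) (gradient v x) := by
    intro x hx
    by_cases hxr : x ∈ ball (0 : Plane) r
    · rw [hgrad x hxr, matForm_smul_left]
      exact mul_nonneg (by positivity) (ha.nonneg hlam hx _)
    · rw [gradient_eq_zero_of_notMem_tsupport fun h => hxr (hts h), matForm_zero_left]
  have hint := integrableOn_matForm_gradient hlam isOpen_ball hm ha hv hφ hc (hts.trans hsub)
  have hzero := (setIntegral_eq_zero_iff_of_nonneg_ae
    ((ae_restrict_mem measurableSet_ball).mono hnn) hint).1 (hw φ hφ hc (hts.trans hsub))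
  have hae : (fun x => max (v x - k) 0 * ‖gradient v x‖ ^ 2)
      =ᵐ[volume.restrict (ball (0 : Plane) r)] fun _ => 0 := by
    filter_upwards [ae_restrict_mem measurableSet_ball,
      ae_restrict_of_ae_restrict_of_subset hsub hzero] with x hx h0
    have h0' : matForm (a x) (gradient φ x) (gradient v x) = 0 := h0
    rw [hgrad x hx, matForm_smul_left] at h0'
    have h1 := ha.lower (hsub hx) (gradient v x)
    have h2 : 0 ≤ max (v x - k) 0 := le_max_right _ _
    have h3 := mul_le_mul_of_nonneg_left h1 h2
    refine le_antisymm ?_ (by positivity)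
    by_contra! h4
    have := mul_pos hlam h4
    nlinarith
  have hev := Measure.eqOn_open_of_ae_eq hae isOpen_ball
    ((((hv.continuousOn.mono hsub).sub continuousOn_const).sup continuousOn_const).mul
      (((continuousOn_gradient isOpen_ball hv).mono hsub).norm.pow 2)) continuousOn_const
  have hfd : ∀ x, fderiv ℝ φ x = 0 := by
    intro x
    rw [← norm_eq_zero, ← norm_gradient_eq, norm_eq_zero]
    by_cases hxr : x ∈ ball (0 : Plane) r
    · rw [hgrad x hxr]
      rcases mul_eq_zero.1 (hev hxr) with h | h
      · rw [h]; simp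
      · rw [norm_eq_zero.1 (pow_eq_zero_iff (two_ne_zero) |>.1 h), smul_zero]
    · exact gradient_eq_zero_of_notMem_tsupport fun h => hxr (hts h)
  have hrpos : 0 < r := pos_of_mem_ball hx₀
  have hconst := is_const_of_fderiv_eq_zero (hφ.differentiable (by norm_num)) hfd x₀ !₂[r, 0]
  have hout : (!₂[r, 0] : Plane) ∉ ball (0 : Plane) r := by
    simp [EuclideanSpace.norm_eq, Real.sqrt_sq_eq_abs, le_abs_self]
  rw [hφdef, Set.indicator_of_mem hx₀, Set.indicator_of_notMem hout,
    max_eq_left (by linarith)] at hconst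
  nlinarith

/-- Logarithmic Caccioppoli inequality for positive weak solutions. -/
lemma IsWeakSolution.integral_log_gradient_le {lam : ℝ} (hlam : 0 < lam) {U : Set Plane}
    (hU : IsOpen U) {a : Plane → Matrix (Fin 2) (Fin 2) ℝ}
    (hm : ∀ i j, Measurable fun x => a x i j)
    (ha : UniformlyElliptic lam U a) {v : Plane → ℝ}
    (hv : ContDiffOn ℝ 1 v U) (hpos : ∀ x ∈ U, 0 < v x) (hw : IsWeakSolution U a v)
    {η : Plane → ℝ} (hη : ContDiff ℝ 1 η) (hηc : HasCompactSupport η) (hηU : tsupport η ⊆ U)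
    (hint : Integrable fun x => (η x / v x) ^ 2 * ‖gradient v x‖ ^ 2) :
    ∫ x, (η x / v x) ^ 2 * ‖gradient v x‖ ^ 2 ≤ 4 * lam⁻¹ ^ 2 * ∫ x, ‖gradient η x‖ ^ 2 := by
  set φ : Plane → ℝ := fun x => η x ^ 2 / v x with hφdef
  have hsupp : Function.support φ ⊆ Function.support η := by
    intro x hx h
    exact hx (by simp [hφdef, h])
  have hts : tsupport φ ⊆ tsupport η := closure_mono hsupp
  have hφc : HasCompactSupport φ := hηc.mono hsupp
  have hφ : ContDiff ℝ 1 φ :=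
    contDiff_of_contDiffOn_of_tsupport_subset hU
      ((hη.contDiffOn.pow 2).div hv fun x hx => (hpos x hx).ne') (hts.trans hηU)
  have hgrad : ∀ x ∈ U, gradient φ x =
      (2 * (η x / v x)) • gradient η x - ((η x / v x) ^ 2) • gradient v x := by
    intro x hx
    have hvx := (hpos x hx).ne'
    have hd : HasFDerivAt v (fderiv ℝ v x) x :=
      ((hv.contDiffAt (hU.mem_nhds hx)).differentiableAt (by norm_num)).hasFDerivAt
    have hd' : HasFDerivAt η (fderiv ℝ η x) x :=
      (hη.differentiable (by norm_num) x).hasFDerivAt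
    have h1 := (hd'.pow 2).mul ((hasDerivAt_inv hvx).comp_hasFDerivAt x hd)
    have h2 : fderiv ℝ φ x =
        (2 * (η x / v x)) • fderiv ℝ η x - ((η x / v x) ^ 2) • fderiv ℝ v x := by
      have h3 : HasFDerivAt φ _ x := h1.congr_of_eventuallyEq
        (Filter.Eventually.of_forall fun y => div_eq_mul_inv _ _)
      rw [h3.fderiv]
      ext y
      simp
      field_simp
      ring
    simp [gradient, h2]
  have hpt : ∀ x ∈ U, lam / 2 * ((η x / v x) ^ 2 * ‖gradient v x‖ ^ 2) ≤
      2 * lam⁻¹ * ‖gradient η x‖ ^ 2 - matForm (a x) (gradient φ x) (gradient v x) := by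
    intro x hx
    set s := η x / v x
    have h1 := two_mul_matForm_le (ha x hx).1 (ha.nonneg hlam hx) (gradient η x)
      (s • gradient v x)
    have h2 := ha.upper hx (gradient η x)
    have h3 := mul_le_mul_of_nonneg_left (ha.lower hx (gradient v x)) (sq_nonneg s)
    simp only [hgrad x hx, matForm_sub_left, matForm_smul_left, matForm_smul_right] at h1 ⊢
    nlinarith
  have hgη : Integrable fun x => ‖gradient η x‖ ^ 2 := by
    refine Continuous.integrable_of_hasCompactSupport ?_ ?_
    · have := continuousOn_gradient isOpen_univ hη.contDiffOn
      exact (continuousOn_univ.1 this).norm.pow 2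
    · refine HasCompactSupport.of_support_subset_isCompact hηc ?_
      intro x hx
      by_contra h
      exact hx (by simp [gradient_eq_zero_of_notMem_tsupport h])
  have hIφ := integrableOn_matForm_gradient hlam hU hm ha hv hφ hφc (hts.trans hηU)
  have hmono := setIntegral_mono_on (hint.integrableOn.const_mul (lam / 2))
    ((hgη.integrableOn.const_mul (2 * lam⁻¹)).sub hIφ) hU.measurableSet hpt
  have hz : ∫ x in U, matForm (a x) (gradient φ x) (gradient v x) = 0 :=
    hw φ hφ hφc (hts.trans hηU)
  simp only [Pi.sub_apply] at hmono
  rw [integral_sub (hgη.integrableOn.const_mul (2 * lam⁻¹)) hIφ, hz, sub_zero,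
    integral_const_mul, integral_const_mul] at hmono
  have e1 : ∫ x in U, (η x / v x) ^ 2 * ‖gradient v x‖ ^ 2 =
      ∫ x, (η x / v x) ^ 2 * ‖gradient v x‖ ^ 2 := by
    refine setIntegral_eq_integral_of_forall_compl_eq_zero fun x hx => ?_
    rw [image_eq_zero_of_notMem_tsupport fun h => hx (hηU h)]
    simp
  have e2 : ∫ x in U, ‖gradient η x‖ ^ 2 = ∫ x, ‖gradient η x‖ ^ 2 := by
    refine setIntegral_eq_integral_of_forall_compl_eq_zero fun x hx => ?_
    rw [gradient_eq_zero_of_notMem_tsupport fun h => hx (hηU h)]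
    simp
  rw [e1, e2] at hmono
  have hl : lam * lam⁻¹ = 1 := mul_inv_cancel₀ hlam.ne'
  have := mul_le_mul_of_nonneg_left hmono (by positivity : 0 ≤ 2 * lam⁻¹)
  calc _ = 2 * lam⁻¹ * (lam / 2 * ∫ x, (η x / v x) ^ 2 * ‖gradient v x‖ ^ 2) := by
        field_simp
    _ ≤ _ := this
    _ = _ := by ring

/-- The point of the plane with polar coordinates `(r, θ)`. -/
def polarPoint (r θ : ℝ) : Plane := !₂[r * Real.cos θ, r * Real.sin θ]

lemma continuous_polarPoint : Continuous fun p : ℝ × ℝ => polarPoint p.1 p.2 := by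
  unfold polarPoint
  refine (PiLp.continuous_toLp 2 _).comp (continuous_pi fun i => ?_)
  fin_cases i <;> simp <;> fun_prop

lemma norm_polarPoint {r : ℝ} (hr : 0 ≤ r) (θ : ℝ) : ‖polarPoint r θ‖ = r := by
  rw [polarPoint, EuclideanSpace.norm_eq]
  simp only [Fin.sum_univ_two, Real.norm_eq_abs, sq_abs]
  simp
  rw [show (r * Real.cos θ) ^ 2 + (r * Real.sin θ) ^ 2 = r ^ 2 by
    linear_combination r ^ 2 * Real.sin_sq_add_cos_sq θ, Real.sqrt_sq hr]

lemma exists_polarPoint_eq {r : ℝ} {x : Plane} (hx : x ∈ sphere (0 : Plane) r) :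
    ∃ θ ∈ Set.Icc (-Real.pi) Real.pi, polarPoint r θ = x := by
  have hn : ‖x‖ = r := by simpa using hx
  set z : ℂ := ⟨x 0, x 1⟩ with hz
  have hzn : ‖z‖ = r := by
    rw [← hn, EuclideanSpace.norm_eq, Complex.norm_def, Complex.normSq_apply]
    simp [hz, Fin.sum_univ_two, sq]
  refine ⟨z.arg, ⟨(Complex.neg_pi_lt_arg z).le, Complex.arg_le_pi z⟩, ?_⟩
  ext i
  fin_cases i
  · have h := Complex.norm_mul_cos_arg z
    rwa [hzn] at h
  · have h := Complex.norm_mul_sin_arg z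
    rwa [hzn] at h

lemma hasDerivAt_polarPoint (r θ : ℝ) :
    HasDerivAt (polarPoint r) (!₂[-(r * Real.sin θ), r * Real.cos θ] : Plane) θ := by
  have h : HasDerivAt (fun t => ![r * Real.cos t, r * Real.sin t])
      ![-(r * Real.sin θ), r * Real.cos θ] θ := by
    rw [hasDerivAt_pi]
    intro i
    fin_cases i
    · simpa using (Real.hasDerivAt_cos θ).const_mul r
    · simpa using (Real.hasDerivAt_sin θ).const_mul r
  exact (PiLp.hasFDerivAt_toLp 2 _).comp_hasDerivAt θ h

lemma norm_deriv_polarPoint {r : ℝ} (hr : 0 ≤ r) (θ : ℝ) :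
    ‖(!₂[-(r * Real.sin θ), r * Real.cos θ] : Plane)‖ = r := by
  rw [EuclideanSpace.norm_eq]
  simp only [Fin.sum_univ_two, Real.norm_eq_abs, sq_abs]
  simp
  rw [show (r * Real.sin θ) ^ 2 + (r * Real.cos θ) ^ 2 = r ^ 2 by
    linear_combination r ^ 2 * Real.sin_sq_add_cos_sq θ, Real.sqrt_sq hr]

/-- Integration in polar coordinates on the Euclidean plane. -/
lemma lintegral_polarPoint (f : Plane → ENNReal) :
    ∫⁻ p in polarCoord.target, ENNReal.ofReal p.1 * f (polarPoint p.1 p.2) = ∫⁻ x, f x := by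
  have hmp : MeasurePreserving
      (fun p : ℝ × ℝ => (MeasurableEquiv.toLp 2 (Fin 2 → ℝ))
        ((MeasurableEquiv.finTwoArrow (α := ℝ)).symm p)) volume volume :=
    (PiLp.volume_preserving_toLp (Fin 2)).comp (volume_preserving_finTwoArrow ℝ).symm
  have h1 := hmp.lintegral_comp_emb
    ((MeasurableEquiv.finTwoArrow (α := ℝ)).symm.trans
      (MeasurableEquiv.toLp 2 (Fin 2 → ℝ))).measurableEmbedding f
  rw [← h1, ← lintegral_comp_polarCoord_symm]
  refine lintegral_congr fun p => ?_
  rw [smul_eq_mul]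
  congr 2

/-- A Courant–Lebesgue selection: some circle carries a controlled share of the integral. -/
lemma exists_radius_integral_le {G : Plane → ℝ} (hG : Continuous G) (hG0 : ∀ x, 0 ≤ G x)
    (hGi : Integrable G) {K : ℝ} (hK : 0 < K) (hGK : ∫ x, G x ≤ K) :
    ∃ r ∈ Set.Ioo (1 / 4 : ℝ) (1 / 2),
      ∫ θ in (-Real.pi)..Real.pi, G (polarPoint r θ) ≤ 32 * K := by
  by_contra! hcon
  have hinner : ∀ r ∈ Set.Ioo (1 / 4 : ℝ) (1 / 2), ENNReal.ofReal (8 * K) ≤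
      ∫⁻ θ in Set.Ioo (-Real.pi) Real.pi,
        ENNReal.ofReal r * ENNReal.ofReal (G (polarPoint r θ)) := by
    intro r hr
    have hcont : Continuous fun θ => G (polarPoint r θ) :=
      hG.comp (continuous_polarPoint.comp (by fun_prop : Continuous fun θ : ℝ => (r, θ)))
    have hi : IntegrableOn (fun θ => G (polarPoint r θ)) (Set.Ioo (-Real.pi) Real.pi) :=
      (hcont.continuousOn.integrableOn_compact isCompact_Icc).mono_set Set.Ioo_subset_Icc_self
    rw [lintegral_const_mul' _ _ ENNReal.ofReal_ne_top,
      ← ofReal_integral_eq_lintegral_ofReal hi (Filter.Eventually.of_forall fun _ => hG0 _),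
      ← ENNReal.ofReal_mul (by linarith [hr.1])]
    refine ENNReal.ofReal_le_ofReal ?_
    have h := hcon r hr
    rw [intervalIntegral.integral_of_le (by linarith [Real.pi_pos]),
      integral_Ioc_eq_integral_Ioo] at h
    nlinarith [hr.1]
  have hsub : Set.Ioo (1 / 4 : ℝ) (1 / 2) ×ˢ Set.Ioo (-Real.pi) Real.pi ⊆ polarCoord.target := by
    rintro ⟨r, θ⟩ ⟨hr, hθ⟩
    refine ⟨?_, hθ⟩
    have : (1 / 4 : ℝ) < r := hr.1
    simp only [Set.mem_Ioi]
    linarith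
  have hmeas : Measurable fun p : ℝ × ℝ =>
      ENNReal.ofReal p.1 * ENNReal.ofReal (G (polarPoint p.1 p.2)) :=
    (ENNReal.measurable_ofReal.comp measurable_fst).mul
      (ENNReal.measurable_ofReal.comp (hG.comp continuous_polarPoint).measurable)
  have hchain : ENNReal.ofReal (2 * K) ≤ ENNReal.ofReal K := calc
    ENNReal.ofReal (2 * K) = ∫⁻ _ in Set.Ioo (1 / 4 : ℝ) (1 / 2), ENNReal.ofReal (8 * K) := by
      rw [setLIntegral_const, Real.volume_Ioo, ← ENNReal.ofReal_mul (by positivity)]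
      congr 1
      ring
    _ ≤ ∫⁻ r in Set.Ioo (1 / 4 : ℝ) (1 / 2), ∫⁻ θ in Set.Ioo (-Real.pi) Real.pi,
        ENNReal.ofReal r * ENNReal.ofReal (G (polarPoint r θ)) :=
      setLIntegral_mono' measurableSet_Ioo hinner
    _ = ∫⁻ p in Set.Ioo (1 / 4 : ℝ) (1 / 2) ×ˢ Set.Ioo (-Real.pi) Real.pi,
        ENNReal.ofReal p.1 * ENNReal.ofReal (G (polarPoint p.1 p.2)) := by
      rw [Measure.volume_eq_prod, setLIntegral_prod _ hmeas.aemeasurable]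
    _ ≤ ∫⁻ p in polarCoord.target,
        ENNReal.ofReal p.1 * ENNReal.ofReal (G (polarPoint p.1 p.2)) := lintegral_mono_set hsub
    _ = ∫⁻ x, ENNReal.ofReal (G x) := lintegral_polarPoint fun x => ENNReal.ofReal (G x)
    _ = ENNReal.ofReal (∫ x, G x) :=
      (ofReal_integral_eq_lintegral_ofReal hGi (Filter.Eventually.of_forall hG0)).symm
    _ ≤ ENNReal.ofReal K := ENNReal.ofReal_le_ofReal hGK
  rw [ENNReal.ofReal_le_ofReal_iff hK.le] at hchain
  linarith

/-- The oscillation of a function of one variable is controlled by an integrable bound on its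
derivative. -/
lemma abs_sub_le_integral_of_abs_deriv_le {f f' h : ℝ → ℝ} {c d : ℝ} (hh : Continuous h)
    (hf' : Continuous f') (hd : ∀ t, HasDerivAt f (f' t) t) (hb : ∀ t, |f' t| ≤ h t) {s t : ℝ}
    (hs : s ∈ Set.Icc c d) (ht : t ∈ Set.Icc c d) : |f t - f s| ≤ ∫ u in c..d, h u := by
  wlog hst : s ≤ t generalizing s t
  · rw [abs_sub_comm]
    exact this ht hs (le_of_not_ge hst)
  rw [← intervalIntegral.integral_eq_sub_of_hasDerivAt (fun u _ => hd u)
    (hf'.intervalIntegrable _ _)]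
  calc |∫ u in s..t, f' u| ≤ ∫ u in s..t, |f' u| :=
        intervalIntegral.abs_integral_le_integral_abs hst
    _ ≤ ∫ u in s..t, h u := intervalIntegral.integral_mono_on hst
        (hf'.abs.intervalIntegrable _ _) (hh.intervalIntegrable _ _) fun u _ => hb u
    _ ≤ ∫ u in c..d, h u := intervalIntegral.integral_mono_interval hs.1 hst ht.2
        (Filter.Eventually.of_forall fun u => (abs_nonneg _).trans (hb u))
        (hh.intervalIntegrable _ _)

/-- Oscillation of `log v` on a circle. -/
lemma le_exp_mul_of_mem_sphere {v : Plane → ℝ} (hv : ContDiffOn ℝ 1 v (ball 0 1))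
    (hpos : ∀ x ∈ ball (0 : Plane) 1, 0 < v x) {r L : ℝ} (hr0 : 0 < r) (hr1 : r < 1)
    (hL : ∫ θ in (-Real.pi)..Real.pi,
      ‖gradient v (polarPoint r θ)‖ ^ 2 / v (polarPoint r θ) ^ 2 ≤ L) {x y : Plane}
    (hx : x ∈ sphere (0 : Plane) r) (hy : y ∈ sphere (0 : Plane) r) :
    v x ≤ Real.exp (2 * Real.pi + L) * v y := by
  obtain ⟨s, hs, rfl⟩ := exists_polarPoint_eq hx
  obtain ⟨t, ht, rfl⟩ := exists_polarPoint_eq hy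
  have hmem : ∀ θ, polarPoint r θ ∈ ball (0 : Plane) 1 := by
    intro θ
    rw [mem_ball_zero_iff, norm_polarPoint hr0.le]
    exact hr1
  have hcp : Continuous (polarPoint r) :=
    continuous_polarPoint.comp (by fun_prop : Continuous fun θ : ℝ => (r, θ))
  have hcv : Continuous fun θ => v (polarPoint r θ) :=
    hv.continuousOn.comp_continuous hcp hmem
  have hcg : Continuous fun θ => gradient v (polarPoint r θ) :=
    (continuousOn_gradient isOpen_ball hv).comp_continuous hcp hmem
  have hcf : Continuous fun θ => fderiv ℝ v (polarPoint r θ) :=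
    (hv.continuousOn_fderiv_of_isOpen isOpen_ball le_rfl).comp_continuous hcp hmem
  have hv0 : ∀ θ, 0 < v (polarPoint r θ) := fun θ => hpos _ (hmem θ)
  set T : ℝ → Plane := fun θ => !₂[-(r * Real.sin θ), r * Real.cos θ] with hT
  have hcT : Continuous T := by
    refine (PiLp.continuous_toLp 2 _).comp (continuous_pi fun i => ?_)
    fin_cases i <;> simp <;> fun_prop
  have hd : ∀ θ, HasDerivAt (fun θ => Real.log (v (polarPoint r θ)))
      (fderiv ℝ v (polarPoint r θ) (T θ) / v (polarPoint r θ)) θ := by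
    intro θ
    have h1 : HasFDerivAt v (fderiv ℝ v (polarPoint r θ)) (polarPoint r θ) :=
      ((hv.contDiffAt (isOpen_ball.mem_nhds (hmem θ))).differentiableAt
        (by norm_num)).hasFDerivAt
    exact (h1.comp_hasDerivAt θ (hasDerivAt_polarPoint r θ)).log (hv0 θ).ne'
  have hcq : Continuous fun θ => ‖gradient v (polarPoint r θ)‖ ^ 2 / v (polarPoint r θ) ^ 2 :=
    (hcg.norm.pow 2).div (hcv.pow 2) fun θ => (pow_pos (hv0 θ) 2).ne'
  have hb : ∀ θ, |fderiv ℝ v (polarPoint r θ) (T θ) / v (polarPoint r θ)| ≤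
      1 + ‖gradient v (polarPoint r θ)‖ ^ 2 / v (polarPoint r θ) ^ 2 := by
    intro θ
    rw [abs_div, abs_of_pos (hv0 θ), ← div_pow]
    have h1 : |fderiv ℝ v (polarPoint r θ) (T θ)| ≤ ‖gradient v (polarPoint r θ)‖ := by
      rw [norm_gradient_eq]
      refine ((fderiv ℝ v (polarPoint r θ)).le_opNorm (T θ)).trans ?_
      rw [hT, norm_deriv_polarPoint hr0.le]
      exact mul_le_of_le_one_right (norm_nonneg _) hr1.le
    have h2 := div_le_div_of_nonneg_right h1 (hv0 θ).le
    nlinarith [sq_nonneg (‖gradient v (polarPoint r θ)‖ / v (polarPoint r θ) - 1 / 2)]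
  have hosc := abs_sub_le_integral_of_abs_deriv_le (continuous_const.add hcq)
    ((hcf.clm_apply hcT).div hcv fun θ => (hv0 θ).ne') hd hb ht hs
  simp only [Pi.add_apply] at hosc
  rw [intervalIntegral.integral_add (continuous_const.intervalIntegrable _ _)
    (hcq.intervalIntegrable _ _), intervalIntegral.integral_const, smul_eq_mul] at hosc
  have h3 : Real.log (v (polarPoint r s)) ≤ 2 * Real.pi + L + Real.log (v (polarPoint r t)) := by
    have := le_abs_self
      (Real.log (v (polarPoint r s)) - Real.log (v (polarPoint r t)))
    linarith
  have h4 := Real.exp_le_exp.2 h3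
  rwa [Real.exp_add, Real.exp_log (hv0 s), Real.exp_log (hv0 t)] at h4

lemma IsWeakSolution.neg {U : Set Plane} {a : Plane → Matrix (Fin 2) (Fin 2) ℝ} {v : Plane → ℝ}
    (hw : IsWeakSolution U a v) : IsWeakSolution U a (fun x => -v x) := by
  intro φ h1 h2 h3
  have h := hw φ h1 h2 h3
  have hg : ∀ x, gradient (fun x => -v x) x = -gradient v x := by
    intro x
    simp [gradient, fderiv_fun_neg]
  simp only [hg, PiLp.neg_apply, mul_neg, Finset.sum_neg_distrib, integral_neg, h, neg_zero]

/-- Comparison on a sphere propagates to the ball. -/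
lemma IsWeakSolution.le_mul_of_sphere {lam : ℝ} (hlam : 0 < lam)
    {a : Plane → Matrix (Fin 2) (Fin 2) ℝ} (hm : ∀ i j, Measurable fun x => a x i j)
    (ha : UniformlyElliptic lam (ball 0 1) a) {v : Plane → ℝ}
    (hv : ContDiffOn ℝ 1 v (ball 0 1)) (hw : IsWeakSolution (ball 0 1) a v)
    {r C : ℝ} (hC : 0 < C) (hr : r < 1)
    (hsph : ∀ x ∈ sphere (0 : Plane) r, ∀ y ∈ sphere (0 : Plane) r, v x ≤ C * v y) :
    ∀ x ∈ ball (0 : Plane) r, ∀ y ∈ ball (0 : Plane) r, v x ≤ C * v y := by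
  intro x hx y hy
  have h1 : ∀ z ∈ sphere (0 : Plane) r, v x ≤ C * v z := fun z hz =>
    hw.le_of_le_sphere hlam hm ha hv hr (fun x' hx' => hsph x' hx' z hz) x hx
  have h2 := hw.neg.le_of_le_sphere hlam hm ha hv.neg hr (M := -(v x / C))
    (fun z hz => neg_le_neg ((div_le_iff₀' hC).2 (h1 z hz))) y hy
  exact (div_le_iff₀' hC).1 (neg_le_neg_iff.1 h2)

/-- Two-dimensional Harnack inequality for positive weak solutions. -/
theorem two_dim_harnack (lam : ℝ) (hlam : lam ∈ Set.Ioc (0 : ℝ) 1) :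
    ∃ C > (0 : ℝ),
      ∀ a : EuclideanSpace ℝ (Fin 2) → Matrix (Fin 2) (Fin 2) ℝ,
        (∀ i j, Measurable fun x => a x i j) →
        UniformlyElliptic lam (ball (0 : EuclideanSpace ℝ (Fin 2)) 1) a →
        ∀ v : EuclideanSpace ℝ (Fin 2) → ℝ,
          ContDiffOn ℝ 1 v (ball (0 : EuclideanSpace ℝ (Fin 2)) 1) →
          (∀ x ∈ ball (0 : EuclideanSpace ℝ (Fin 2)) 1, 0 < v x) →
          IsWeakSolution (ball (0 : EuclideanSpace ℝ (Fin 2)) 1) a v →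
          sSup (v '' ball (0 : EuclideanSpace ℝ (Fin 2)) (1 / 4)) ≤
            C * sInf (v '' ball (0 : EuclideanSpace ℝ (Fin 2)) (1 / 4)) := by
  have hl : 0 < lam := hlam.1
  let η : ContDiffBump (0 : Plane) := ⟨1 / 2, 3 / 4, by norm_num, by norm_num⟩
  set K : ℝ := 4 * lam⁻¹ ^ 2 * (∫ x, ‖gradient η x‖ ^ 2) + 1 with hKdef
  have hK : 0 < K := by
    have : 0 ≤ ∫ x, ‖gradient η x‖ ^ 2 := integral_nonneg fun x => by positivity
    positivity
  set C : ℝ := Real.exp (2 * Real.pi + 32 * K) with hCdef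
  have hC : 0 < C := Real.exp_pos _
  refine ⟨C, hC, fun a hm ha v hv hpos hw => ?_⟩
  have hη : ContDiff ℝ 1 η := η.contDiff
  have hηU : tsupport η ⊆ ball (0 : Plane) 1 := by
    rw [η.tsupport_eq]
    exact closedBall_subset_ball (by norm_num)
  set G : Plane → ℝ := fun x => (η x / v x) ^ 2 * ‖gradient v x‖ ^ 2 with hGdef
  have hGs : tsupport G ⊆ tsupport η := by
    refine closure_mono fun x hx h => hx ?_
    simp [hGdef, h]
  have hGc : HasCompactSupport G :=
    HasCompactSupport.of_support_subset_isCompact η.hasCompactSupport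
      ((subset_tsupport G).trans hGs)
  have hG : Continuous G := by
    refine continuous_of_tsupport fun x hx => ?_
    have hc : ContinuousOn G (ball 0 1) :=
      ((η.continuous.continuousOn.div hv.continuousOn fun x hx => (hpos x hx).ne').pow 2).mul
        ((continuousOn_gradient isOpen_ball hv).norm.pow 2)
    exact hc.continuousAt (isOpen_ball.mem_nhds (hηU (hGs hx)))
  have hGi : Integrable G := hG.integrable_of_hasCompactSupport hGc
  have hGK : ∫ x, G x ≤ K :=
    (hw.integral_log_gradient_le hl isOpen_ball hm ha hv hpos hη η.hasCompactSupport hηU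
      hGi).trans (by linarith)
  obtain ⟨r, hr, hrK⟩ := exists_radius_integral_le hG (fun x => by positivity) hGi hK hGK
  have hr0 : 0 < r := by linarith [hr.1]
  have hr1 : r < 1 := by linarith [hr.2]
  have hGr : ∀ θ, G (polarPoint r θ) =
      ‖gradient v (polarPoint r θ)‖ ^ 2 / v (polarPoint r θ) ^ 2 := by
    intro θ
    have h1 : η (polarPoint r θ) = 1 := by
      refine η.one_of_mem_closedBall ?_
      rw [mem_closedBall_zero_iff, norm_polarPoint hr0.le]
      exact hr.2.le
    simp only [hGdef, h1]
    ring
  simp only [hGr] at hrK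
  have hball := hw.le_mul_of_sphere hl hm ha hv hC hr1 fun x hx y hy =>
    le_exp_mul_of_mem_sphere hv hpos hr0 hr1 hrK hx hy
  have hsub : ball (0 : Plane) (1 / 4) ⊆ ball 0 r := ball_subset_ball hr.1.le
  have hne : (v '' ball (0 : Plane) (1 / 4)).Nonempty :=
    (nonempty_ball.2 (by norm_num)).image v
  refine csSup_le hne ?_
  rintro _ ⟨x, hx, rfl⟩
  rw [← div_le_iff₀' hC]
  refine le_csInf hne ?_
  rintro _ ⟨y, hy, rfl⟩
  exact (div_le_iff₀' hC).2 (hball x (hsub hx) y (hsub hy))
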